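/- Let N ≥ 3 be an integer, let a, b be reals with 0 < a < (N−2)/2 and a < b < a+1, set d := 1+a−b, 2♯ := 2N/(N−2d), q_c := (4+2N)/(N−2a+2b), δ_{q_c} := 2/q_c. Let ρ > 0 and 0 < β < q_c/(2 C_{a,b}^{q_c} ρ^{4d/(N−2a+2b)}). Then for every radial u ∈ C_c^∞(ℝ^N), u ≠ 0, with ∫|x|^{−2a}|u|² dx = ρ² and P_β(u) := A(u) − βδ_{q_c}B_{q_c}(u) − B_{2♯}(u) = 0, one has: (a) A(u)^{(2♯−2)/2} ≥ S(a,b)^{2♯/2}·(1 − (2β/q_c)C_{a,b}^{q_c}ρ^{4d/(N−2a+2b)}); (b) E_β(u) := (1/2)A(u) − (β/q_c)B_{q_c}(u) − (1/2♯)B_{2♯}(u) satisfies E_β(u) ≥ (d/N)(1 − (2β/q_c)C_{a,b}^{q_c}ρ^{4d/(N−2a+2b)})·A(u) > 0. -/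

import Mathlib

open MeasureTheory Real Set Filter Asymptotics

noncomputable section

abbrev E (N : ℕ) := EuclideanSpace ℝ (Fin N)

/-- Weighted gradient integral `∫ |x|^{-2a} |∇u|²`. -/
def Aint (N : ℕ) (a : ℝ) (u : E N → ℝ) : ℝ :=
  ∫ x : E N, ‖x‖ ^ (-(2 * a)) * ‖fderiv ℝ u x‖ ^ 2

/-- Weighted mass `∫ |x|^{-2a} |u|²`. -/
def mint (N : ℕ) (a : ℝ) (u : E N → ℝ) : ℝ :=
  ∫ x : E N, ‖x‖ ^ (-(2 * a)) * (u x) ^ 2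

/-- Weighted `L^s` integral `∫ |x|^{-bs} |u|^s`. -/
def Bint (N : ℕ) (b s : ℝ) (u : E N → ℝ) : ℝ :=
  ∫ x : E N, ‖x‖ ^ (-(b * s)) * |u x| ^ s

/-- A function on `ℝ^N` is radial if it depends only on the norm. -/
def IsRadial {N : ℕ} (u : E N → ℝ) : Prop :=
  ∀ x y : E N, ‖x‖ = ‖y‖ → u x = u y

/-- The best Caffarelli–Kohn–Nirenberg constant `S(a,b)` (with critical exponent `p = 2♯`). -/
def Sab (N : ℕ) (a b p : ℝ) : ℝ :=
  sInf {r : ℝ | ∃ u : E N → ℝ, ContDiff ℝ (⊤ : ℕ∞) u ∧ HasCompactSupport u ∧ u ≠ 0 ∧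
    r = Aint N a u / (Bint N b p u) ^ (2 / p)}

lemma Aint_nonneg (N : ℕ) (a : ℝ) (u : E N → ℝ) : 0 ≤ Aint N a u :=
  integral_nonneg fun _ => by positivity

lemma Bint_nonneg (N : ℕ) (b s : ℝ) (u : E N → ℝ) : 0 ≤ Bint N b s u :=
  integral_nonneg fun _ => by positivity

lemma locallyIntegrable_norm_rpow {N : ℕ} (hN : 1 ≤ N) {s : ℝ} (hs : -(N : ℝ) < s) :
    LocallyIntegrable (fun x : E N => ‖x‖ ^ s) := by
  have : Nonempty (Fin N) := ⟨⟨0, hN⟩⟩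
  rw [locallyIntegrable_iff]
  intro K hK
  obtain ⟨r, hr, hKr⟩ := hK.isBounded.subset_ball_lt 0 0
  refine IntegrableOn.mono_set ?_ hKr
  rw [integrableOn_fun_norm_addHaar volume (f := fun y : ℝ => y ^ s)]
  have h : IntegrableOn (fun y : ℝ => y ^ ((N : ℝ) - 1 + s)) (Ioo 0 r) :=
    (intervalIntegral.integrableOn_Ioo_rpow_iff hr).2 (by linarith)
  refine h.congr_fun (fun y hy => ?_) measurableSet_Ioo
  simp only [finrank_euclideanSpace, Fintype.card_fin, smul_eq_mul]
  rw [Real.rpow_add hy.1, ← Real.rpow_natCast y (N - 1), Nat.cast_sub hN, Nat.cast_one]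

lemma Aint_pos {N : ℕ} (hN : 1 ≤ N) {a : ℝ} (ha : 2 * a < N) {u : E N → ℝ}
    (hu : ContDiff ℝ (⊤ : ℕ∞) u) (hc : HasCompactSupport u) (h0 : u ≠ 0) :
    0 < Aint N a u := by
  have : Nonempty (Fin N) := ⟨⟨0, hN⟩⟩
  have hcont : Continuous (fderiv ℝ u) := hu.continuous_fderiv (by simp)
  have hint : Integrable fun x : E N => ‖x‖ ^ (-(2 * a)) * ‖fderiv ℝ u x‖ ^ 2 := by
    have hsupp : HasCompactSupport fun x => ‖fderiv ℝ u x‖ ^ 2 :=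
      (hc.fderiv ℝ).comp_left (g := fun L => ‖L‖ ^ 2) (by simp)
    exact (locallyIntegrable_norm_rpow hN (by linarith)).integrable_smul_right_of_hasCompactSupport
      (hcont.norm.pow 2) hsupp
  have hnn : 0 ≤ fun x : E N => ‖x‖ ^ (-(2 * a)) * ‖fderiv ℝ u x‖ ^ 2 :=
    fun _ => by positivity
  refine (Aint_nonneg N a u).lt_of_ne' fun hA => h0 ?_
  have hae := (integral_eq_zero_iff_of_nonneg hnn hint).1 hA
  have hD : fderiv ℝ u = 0 := by
    refine (hcont.ae_eq_iff_eq volume continuous_zero).1 ?_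
    filter_upwards [hae, Measure.ae_ne volume (0 : E N)] with x hx hx0
    have hw : ‖x‖ ^ (-(2 * a)) ≠ 0 := (Real.rpow_pos_of_pos (norm_pos_iff.2 hx0) _).ne'
    have h : fderiv ℝ u x = 0 := by simpa [hw] using hx
    exact h
  have hconst := is_const_of_fderiv_eq_zero (𝕜 := ℝ) (hu.differentiable (by simp))
    (fun x => congrFun hD x)
  obtain ⟨y, hy⟩ : ∃ y, u y = 0 := by
    by_contra! hne
    have : tsupport u = univ := by
      rw [tsupport, Function.support_eq_univ hne, closure_univ]
    exact noncompact_univ (E N) (this ▸ hc)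
  funext x
  rw [hconst x y, hy, Pi.zero_apply]

lemma Sab_nonneg (N : ℕ) (a b p : ℝ) : 0 ≤ Sab N a b p := by
  refine Real.sInf_nonneg ?_
  rintro r ⟨u, -, -, -, rfl⟩
  exact div_nonneg (Aint_nonneg N a u) (Real.rpow_nonneg (Bint_nonneg N b p u) _)

lemma Sab_le {N : ℕ} {a b p : ℝ} {u : E N → ℝ}
    (hu : ContDiff ℝ (⊤ : ℕ∞) u) (hc : HasCompactSupport u) (h0 : u ≠ 0) :
    Sab N a b p ≤ Aint N a u / Bint N b p u ^ (2 / p) := by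
  refine csInf_le ⟨0, ?_⟩ ⟨u, hu, hc, h0, rfl⟩
  rintro r ⟨v, -, -, -, rfl⟩
  exact div_nonneg (Aint_nonneg N a v) (Real.rpow_nonneg (Bint_nonneg N b p v) _)

lemma Sab_rpow_mul_Bint_le {N : ℕ} {a b p : ℝ} (hp : 0 < p) {u : E N → ℝ}
    (hu : ContDiff ℝ (⊤ : ℕ∞) u) (hc : HasCompactSupport u) (h0 : u ≠ 0)
    (hB : 0 < Bint N b p u) :
    Sab N a b p ^ (p / 2) * Bint N b p u ≤ Aint N a u ^ (p / 2) := by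
  rw [← le_div_iff₀ hB]
  calc Sab N a b p ^ (p / 2)
      ≤ (Aint N a u / Bint N b p u ^ (2 / p)) ^ (p / 2) :=
        Real.rpow_le_rpow (Sab_nonneg N a b p) (Sab_le hu hc h0) (by positivity)
    _ = Aint N a u ^ (p / 2) / Bint N b p u := by
        rw [Real.div_rpow (Aint_nonneg N a u) (by positivity), ← Real.rpow_mul hB.le,
          show 2 / p * (p / 2) = 1 by field_simp, Real.rpow_one]

/-- The Gagliardo–Nirenberg inequality raised to the power `q`. -/
lemma Bint_le_of_rpow_le {N : ℕ} {a b q ρ C : ℝ} (hq : 0 < q) (hρ : 0 < ρ) (hC : 0 < C)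
    {u : E N → ℝ} (hm : mint N a u = ρ ^ 2)
    (h : Bint N b q u ^ (1 / q) ≤
      C * Aint N a u ^ ((2 / q) / 2) * mint N a u ^ ((1 - 2 / q) / 2)) :
    Bint N b q u ≤ C ^ q * ρ ^ (q - 2) * Aint N a u := by
  have hA := Aint_nonneg N a u
  have hB := Bint_nonneg N b q u
  calc Bint N b q u = (Bint N b q u ^ (1 / q)) ^ q := by
        rw [← Real.rpow_mul hB, one_div_mul_cancel hq.ne', Real.rpow_one]
    _ ≤ (C * Aint N a u ^ ((2 / q) / 2) * mint N a u ^ ((1 - 2 / q) / 2)) ^ q :=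
        Real.rpow_le_rpow (by positivity) h hq.le
    _ = C ^ q * ρ ^ (q - 2) * Aint N a u := by
        rw [hm, Real.mul_rpow (by positivity) (by positivity),
          Real.mul_rpow hC.le (by positivity), ← Real.rpow_mul hA, ← Real.rpow_natCast ρ 2,
          ← Real.rpow_mul hρ.le, ← Real.rpow_mul hρ.le,
          show 2 / q / 2 * q = 1 by field_simp,
          show ((2 : ℕ) : ℝ) * ((1 - 2 / q) / 2) * q = q - 2 by push_cast; field_simp,
          Real.rpow_one]
        ring

/-- Lemma 5.3 (mass-critical bounds on the Pohozaev manifold): for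
`0 < β < q_c/(2C^{q_c}ρ^{4d/(N-2a+2b)})` and any nonzero radial test function `u` of mass
`ρ²` with `P_β(u) = 0`: (a) `A(u)^{(2♯-2)/2} ≥ S(a,b)^{2♯/2}(1 - (2β/q_c)C^{q_c}ρ^{4d/(N-2a+2b)})`
and (b) `E_β(u) ≥ (d/N)(1 - (2β/q_c)C^{q_c}ρ^{4d/(N-2a+2b)})A(u) > 0`. -/
theorem masscritical_pohozaev_bounds (N : ℕ) (hN : 3 ≤ N) (a b d p qc ρ β Cab : ℝ)
    (ha : 0 < a) (ha' : a < ((N : ℝ) - 2) / 2) (hab : a < b) (hb : b < a + 1)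
    (hd : d = 1 + a - b) (hp : p = 2 * N / ((N : ℝ) - 2 * d))
    (hqc : qc = (4 + 2 * N) / ((N : ℝ) - 2 * a + 2 * b))
    (hρ : 0 < ρ)
    (hCab : IsLeast {C : ℝ | 0 < C ∧ ∀ u : E N → ℝ,
      ContDiff ℝ (⊤ : ℕ∞) u → HasCompactSupport u →
        (Bint N b qc u) ^ (1 / qc) ≤
          C * (Aint N a u) ^ ((2 / qc) / 2) * (mint N a u) ^ ((1 - 2 / qc) / 2)} Cab)
    (hβ : 0 < β)
    (hβ' : β < qc / (2 * Cab ^ qc * ρ ^ (4 * d / ((N : ℝ) - 2 * a + 2 * b)))) :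
    ∀ u : E N → ℝ, ContDiff ℝ (⊤ : ℕ∞) u → HasCompactSupport u → IsRadial u → u ≠ 0 →
      mint N a u = ρ ^ 2 →
      Aint N a u - β * (2 / qc) * Bint N b qc u - Bint N b p u = 0 →
      ((Aint N a u) ^ ((p - 2) / 2) ≥ (Sab N a b p) ^ (p / 2) *
        (1 - (2 * β / qc) * Cab ^ qc * ρ ^ (4 * d / ((N : ℝ) - 2 * a + 2 * b)))) ∧
      ((1 / 2) * Aint N a u - (β / qc) * Bint N b qc u - (1 / p) * Bint N b p u ≥
        (d / (N : ℝ)) * (1 - (2 * β / qc) * Cab ^ qc *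
          ρ ^ (4 * d / ((N : ℝ) - 2 * a + 2 * b))) * Aint N a u) ∧
      0 < (1 / 2) * Aint N a u - (β / qc) * Bint N b qc u - (1 / p) * Bint N b p u := by
  intro u hu hc _ h0 hm hP
  have hN' : (3 : ℝ) ≤ N := by exact_mod_cast hN
  have hden : 0 < (N : ℝ) - 2 * a + 2 * b := by linarith
  have hden' : 0 < (N : ℝ) - 2 * d := by linarith
  have hd0 : 0 < d := by linarith
  have hq : 0 < qc := by rw [hqc]; positivity
  have hp0 : 0 < p := by rw [hp]; positivity
  have hp_inv : 1 / p = 1 / 2 - d / N := by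
    rw [hp]; field_simp
  have hexp : qc - 2 = 4 * d / ((N : ℝ) - 2 * a + 2 * b) := by
    rw [hqc, hd]; field_simp; ring
  obtain ⟨hC, hGN⟩ := hCab.1
  have hA : 0 < Aint N a u := Aint_pos (by omega) (by linarith) hu hc h0
  have hB := Bint_le_of_rpow_le hq hρ hC hm (hGN u hu hc)
  rw [← hexp] at hβ' ⊢
  rw [lt_div_iff₀ (by positivity)] at hβ'
  set κ := 1 - 2 * β / qc * Cab ^ qc * ρ ^ (qc - 2) with hκ
  have hκ0 : 0 < κ := by
    have : 2 * β / qc * Cab ^ qc * ρ ^ (qc - 2) < 1 := by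
      rw [show 2 * β / qc * Cab ^ qc * ρ ^ (qc - 2) =
        β * (2 * Cab ^ qc * ρ ^ (qc - 2)) / qc by ring, div_lt_one hq]
      exact hβ'
    linarith
  have hBp : κ * Aint N a u ≤ Bint N b p u := by
    have h := mul_le_mul_of_nonneg_left hB (show 0 ≤ β * (2 / qc) by positivity)
    have hκA : κ * Aint N a u =
        Aint N a u - β * (2 / qc) * (Cab ^ qc * ρ ^ (qc - 2) * Aint N a u) := by
      rw [hκ]; ring
    linarith
  have hBp0 : 0 < Bint N b p u := (mul_pos hκ0 hA).trans_le hBp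
  have hE : (1 / 2) * Aint N a u - (β / qc) * Bint N b qc u - (1 / p) * Bint N b p u =
      d / N * Bint N b p u := by
    rw [hp_inv]; linear_combination (1 / 2) * hP
  have hdN : 0 < d / (N : ℝ) := by positivity
  rw [hE]
  refine ⟨?_, ?_, by positivity⟩
  · rw [sub_div, div_self two_ne_zero, Real.rpow_sub_one hA.ne', ge_iff_le, le_div_iff₀ hA,
      mul_assoc]
    exact (mul_le_mul_of_nonneg_left hBp (Real.rpow_nonneg (Sab_nonneg N a b p) _)).trans
      (Sab_rpow_mul_Bint_le hp0 hu hc h0 hBp0)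
  · rw [mul_assoc]
    exact mul_le_mul_of_nonneg_left hBp hdN.le
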